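/- arXiv:2105.09715 — 2 statements merged into one kernel-verified Lean document; each statement's English description precedes it below -/
import Mathlib

section
/- Let A ∈ B(H). Then w(A) = ‖A‖/2 if and only if ‖Re(e^{iθ}A)‖ = ‖Im(e^{iθ}A)‖ = ‖A‖/2 for all θ ∈ ℝ. -/
open ContinuousLinearMap Filter
open scoped ComplexInnerProductSpace Topology

variable {H : Type*} [NormedAddCommGroup H] [InnerProductSpace ℂ H]
  [CompleteSpace H] [Nontrivial H]

/-- The numerical range of a bounded linear operator. -/
noncomputable def numRange (A : H →L[ℂ] H) : Set ℂ :=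
  {z : ℂ | ∃ x : H, ‖x‖ = 1 ∧ z = ⟪x, A x⟫}

/-- The numerical radius of a bounded linear operator. -/
noncomputable def numRadius (A : H →L[ℂ] H) : ℝ :=
  sSup {r : ℝ | ∃ x : H, ‖x‖ = 1 ∧ r = ‖(⟪x, A x⟫)‖}

/-- The Crawford number of a bounded linear operator. -/
noncomputable def crawford (A : H →L[ℂ] H) : ℝ :=
  sInf {r : ℝ | ∃ x : H, ‖x‖ = 1 ∧ r = ‖(⟪x, A x⟫)‖}

/-- The real part `(A + A*)/2` of a bounded linear operator. -/
noncomputable def reOp (A : H →L[ℂ] H) : H →L[ℂ] H :=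
  (2 : ℂ)⁻¹ • (A + ContinuousLinearMap.adjoint A)

/-- The imaginary part `(A - A*)/(2i)` of a bounded linear operator. -/
noncomputable def imOp (A : H →L[ℂ] H) : H →L[ℂ] H :=
  (2 * Complex.I)⁻¹ • (A - ContinuousLinearMap.adjoint A)

omit [CompleteSpace H] [Nontrivial H] in
lemma norm_inner_apply_le_opNorm (A : H →L[ℂ] H) {x : H} (hx : ‖x‖ = 1) :
    ‖⟪x, A x⟫‖ ≤ ‖A‖ := by
  calc ‖⟪x, A x⟫‖ ≤ ‖x‖ * ‖A x‖ := norm_inner_le_norm _ _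
    _ ≤ ‖A‖ := by simpa [hx] using A.le_opNorm x

omit [CompleteSpace H] [Nontrivial H] in
lemma norm_inner_apply_le_numRadius (A : H →L[ℂ] H) {x : H} (hx : ‖x‖ = 1) :
    ‖⟪x, A x⟫‖ ≤ numRadius A := by
  refine le_csSup ⟨‖A‖, ?_⟩ ⟨x, hx, rfl⟩
  rintro r ⟨y, hy, rfl⟩
  exact norm_inner_apply_le_opNorm A hy

omit [CompleteSpace H] in
lemma numRadius_le {A : H →L[ℂ] H} {c : ℝ} (h : ∀ x : H, ‖x‖ = 1 → ‖⟪x, A x⟫‖ ≤ c) :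
    numRadius A ≤ c := by
  obtain ⟨x, hx⟩ := exists_norm_eq H zero_le_one
  refine csSup_le ⟨_, x, hx, rfl⟩ ?_
  rintro r ⟨y, hy, rfl⟩
  exact h y hy

omit [CompleteSpace H] in
lemma numRadius_smul_le (A : H →L[ℂ] H) {c : ℂ} (hc : ‖c‖ = 1) :
    numRadius (c • A) ≤ numRadius A :=
  numRadius_le fun x hx => by
    simpa [inner_smul_right, hc] using norm_inner_apply_le_numRadius A hx

omit [Nontrivial H] in
lemma inner_reOp_apply_self (A : H →L[ℂ] H) (x : H) :
    ⟪x, reOp A x⟫ = ((⟪x, A x⟫.re : ℝ) : ℂ) := by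
  have h : ⟪x, ContinuousLinearMap.adjoint A x⟫ = (starRingEnd ℂ) ⟪x, A x⟫ := by
    rw [adjoint_inner_right, inner_conj_symm]
  simp only [reOp, smul_apply, add_apply, inner_smul_right, inner_add_right, h, Complex.add_conj]
  push_cast
  ring

omit [Nontrivial H] in
lemma isSelfAdjoint_reOp (A : H →L[ℂ] H) : IsSelfAdjoint (reOp A) := by
  simp [IsSelfAdjoint, reOp, star_eq_adjoint, add_comm]

lemma norm_reOp_le_numRadius (A : H →L[ℂ] H) : ‖reOp A‖ ≤ numRadius A := by
  rw [norm_eq_iSup_rayleighQuotient _ (isSelfAdjoint_reOp A).isSymmetric]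
  refine ciSup_le fun x => ?_
  rcases eq_or_ne x 0 with rfl | hx
  · obtain ⟨y, hy⟩ := exists_norm_eq H zero_le_one
    simpa [rayleighQuotient] using (norm_nonneg _).trans (norm_inner_apply_le_numRadius A hy)
  · have hx' : (‖x‖⁻¹ : ℂ) ≠ 0 := by simpa using hx
    have hu : ‖(‖x‖⁻¹ : ℂ) • x‖ = 1 := by simp [norm_smul, hx]
    rw [← rayleigh_smul _ x hx', rayleighQuotient, reApplyInnerSelf_apply, hu, one_pow, div_one,
      inner_re_symm, inner_reOp_apply_self]
    exact (Complex.abs_re_le_norm _).trans (norm_inner_apply_le_numRadius A hu)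

omit [Nontrivial H] in
lemma imOp_eq_reOp (A : H →L[ℂ] H) : imOp A = reOp ((-Complex.I) • A) := by
  simp only [imOp, reOp, map_smulₛₗ, smul_sub, smul_add, smul_smul, mul_inv, Complex.inv_I,
    map_neg, Complex.conj_I, neg_neg]
  module

omit [Nontrivial H] in
lemma reOp_add_I_smul_imOp (A : H →L[ℂ] H) : reOp A + Complex.I • imOp A = A := by
  have h : Complex.I * (2 * Complex.I)⁻¹ = 2⁻¹ := by field_simp
  rw [reOp, imOp, smul_smul, h]
  module

omit [Nontrivial H] in
lemma norm_inner_apply_le_of_norm_reOp_le {A : H →L[ℂ] H} {c : ℝ}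
    (h : ∀ θ : ℝ, ‖reOp (Complex.exp (θ * Complex.I) • A)‖ ≤ c) {x : H} (hx : ‖x‖ = 1) :
    ‖⟪x, A x⟫‖ ≤ c := by
  set z := ⟪x, A x⟫ with hz
  have hrot : Complex.exp ((-z.arg : ℝ) * Complex.I) * z = ‖z‖ := by
    conv_lhs => rw [← Complex.norm_mul_exp_arg_mul_I z]
    rw [mul_left_comm, ← Complex.exp_add]
    simp
  have key := (norm_inner_apply_le_opNorm _ hx).trans (h (-z.arg))
  rw [inner_reOp_apply_self, smul_apply, inner_smul_right, ← hz, hrot] at key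
  simpa using key

/-- `w(A) = ‖A‖/2` iff `‖Re(e^{iθ}A)‖ = ‖Im(e^{iθ}A)‖ = ‖A‖/2` for all `θ ∈ ℝ`. -/
theorem stmt3 (A : H →L[ℂ] H) :
    numRadius A = ‖A‖ / 2 ↔
      ∀ θ : ℝ, ‖reOp (Complex.exp (θ * Complex.I) • A)‖ = ‖A‖ / 2 ∧
        ‖imOp (Complex.exp (θ * Complex.I) • A)‖ = ‖A‖ / 2 := by
  constructor
  · intro hw θ
    set B := Complex.exp (θ * Complex.I) • A
    have hexp : ‖Complex.exp (θ * Complex.I)‖ = 1 := Complex.norm_exp_ofReal_mul_I θ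
    have hB : numRadius B ≤ ‖A‖ / 2 := (numRadius_smul_le A hexp).trans hw.le
    have hre : ‖reOp B‖ ≤ ‖A‖ / 2 := (norm_reOp_le_numRadius B).trans hB
    have him : ‖imOp B‖ ≤ ‖A‖ / 2 := by
      rw [imOp_eq_reOp]
      exact (norm_reOp_le_numRadius _).trans ((numRadius_smul_le B (by simp)).trans hB)
    have hsum : ‖A‖ ≤ ‖reOp B‖ + ‖imOp B‖ := by
      calc ‖A‖ = ‖B‖ := by rw [norm_smul, hexp, one_mul]
        _ = ‖reOp B + Complex.I • imOp B‖ := by rw [reOp_add_I_smul_imOp]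
        _ ≤ ‖reOp B‖ + ‖imOp B‖ := by
          simpa [norm_smul] using norm_add_le (reOp B) (Complex.I • imOp B)
    constructor <;> linarith
  · intro h
    refine le_antisymm
      (numRadius_le fun x hx => norm_inner_apply_le_of_norm_reOp_le (fun θ => (h θ).1.le) hx) ?_
    have h0 : ‖reOp A‖ = ‖A‖ / 2 := by simpa using (h 0).1
    exact h0 ▸ norm_reOp_le_numRadius A
end

section
/- For every A ∈ B(H), w(A)² ≥ ‖Re(A)‖² + c(Im(A))² and w(A)² ≥ ‖Im(A)‖² + c(Re(A))². -/
open ContinuousLinearMap Filter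
open scoped ComplexInnerProductSpace Topology

variable {H : Type*} [NormedAddCommGroup H] [InnerProductSpace ℂ H]
  [CompleteSpace H] [Nontrivial H]

theorem inner_adjoint_apply_self {E : Type*} [NormedAddCommGroup E] [InnerProductSpace ℂ E]
    [CompleteSpace E] (A : E →L[ℂ] E) (x : E) :
    ⟪x, ContinuousLinearMap.adjoint A x⟫ = (starRingEnd ℂ) ⟪x, A x⟫ := by
  rw [ContinuousLinearMap.adjoint_inner_right, inner_conj_symm]

theorem inner_reOp {E : Type*} [NormedAddCommGroup E] [InnerProductSpace ℂ E]
    [CompleteSpace E] (A : E →L[ℂ] E) (x : E) : ⟪x, reOp A x⟫ = ((⟪x, A x⟫).re : ℂ) := by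
  simp only [reOp, smul_apply, add_apply, inner_smul_right, inner_add_right,
    inner_adjoint_apply_self, Complex.re_eq_add_conj]
  ring

theorem inner_imOp {E : Type*} [NormedAddCommGroup E] [InnerProductSpace ℂ E]
    [CompleteSpace E] (A : E →L[ℂ] E) (x : E) : ⟪x, imOp A x⟫ = ((⟪x, A x⟫).im : ℂ) := by
  simp only [imOp, smul_apply, sub_apply, inner_smul_right, inner_sub_right,
    inner_adjoint_apply_self, Complex.im_eq_sub_conj]
  ring

theorem isSymmetric_of_inner_self_real {E : Type*} [NormedAddCommGroup E]
    [InnerProductSpace ℂ E] {S : E →L[ℂ] E} {f : E → ℝ}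
    (h : ∀ x, ⟪x, S x⟫ = (f x : ℂ)) : (S : E →ₗ[ℂ] E).IsSymmetric := by
  rw [LinearMap.isSymmetric_iff_inner_map_self_real]
  intro x
  rw [inner_conj_symm, coe_coe, ← inner_conj_symm (S x) x, h, Complex.conj_ofReal]

theorem sq_norm_inner_eq_add {E : Type*} [NormedAddCommGroup E] [InnerProductSpace ℂ E]
    [CompleteSpace E] (A : E →L[ℂ] E) (x : E) :
    ‖⟪x, A x⟫‖ ^ 2 = ‖⟪x, reOp A x⟫‖ ^ 2 + ‖⟪x, imOp A x⟫‖ ^ 2 := by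
  rw [inner_reOp, inner_imOp, Complex.norm_real, Complex.norm_real, Real.norm_eq_abs,
    Real.norm_eq_abs, sq_abs, sq_abs, Complex.sq_norm, Complex.normSq_apply]
  ring

theorem norm_inner_le_numRadius {E : Type*} [NormedAddCommGroup E] [InnerProductSpace ℂ E]
    (A : E →L[ℂ] E) {x : E} (hx : ‖x‖ = 1) :
    ‖⟪x, A x⟫‖ ≤ numRadius A := by
  refine le_csSup ⟨‖A‖, ?_⟩ ⟨x, hx, rfl⟩
  rintro _ ⟨y, hy, rfl⟩
  calc ‖⟪y, A y⟫‖ ≤ ‖y‖ * ‖A y‖ := norm_inner_le_norm _ _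
    _ ≤ ‖y‖ * (‖A‖ * ‖y‖) := by gcongr; exact A.le_opNorm y
    _ = ‖A‖ := by simp [hy]

theorem crawford_nonneg {E : Type*} [NormedAddCommGroup E] [InnerProductSpace ℂ E]
    (A : E →L[ℂ] E) : 0 ≤ crawford A :=
  Real.sInf_nonneg (by rintro _ ⟨x, -, rfl⟩; exact norm_nonneg _)

theorem crawford_le_norm_inner {E : Type*} [NormedAddCommGroup E] [InnerProductSpace ℂ E]
    (A : E →L[ℂ] E) {x : E} (hx : ‖x‖ = 1) :
    crawford A ≤ ‖⟪x, A x⟫‖ :=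
  csInf_le ⟨0, by rintro _ ⟨y, -, rfl⟩; exact norm_nonneg _⟩ ⟨x, hx, rfl⟩

theorem norm_le_of_norm_inner_le {E : Type*} [NormedAddCommGroup E] [InnerProductSpace ℂ E]
    {S : E →L[ℂ] E} (hS : (S : E →ₗ[ℂ] E).IsSymmetric) {M : ℝ} (hM : 0 ≤ M)
    (h : ∀ x : E, ‖x‖ = 1 → ‖⟪x, S x⟫‖ ≤ M) : ‖S‖ ≤ M := by
  rw [norm_eq_iSup_rayleighQuotient S hS]
  refine ciSup_le fun x ↦ ?_
  rcases eq_or_ne x 0 with rfl | hx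
  · simpa using hM
  · have hc : ((‖x‖⁻¹ : ℝ) : ℂ) ≠ 0 := by simpa using hx
    have hu : ‖((‖x‖⁻¹ : ℝ) : ℂ) • x‖ = 1 := by
      rw [norm_smul, Complex.norm_real, norm_inv, norm_norm, inv_mul_cancel₀ (by simpa using hx)]
    rw [← rayleigh_smul S x hc, rayleighQuotient, hu, reApplyInnerSelf_apply, one_pow, div_one]
    refine (RCLike.abs_re_le_norm _).trans ?_
    rw [norm_inner_symm]
    exact h _ hu

theorem sq_norm_add_sq_crawford_le {E : Type*} [NormedAddCommGroup E] [InnerProductSpace ℂ E]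
    [Nontrivial E] {A S T : E →L[ℂ] E}
    (hS : (S : E →ₗ[ℂ] E).IsSymmetric)
    (h : ∀ x, ‖⟪x, A x⟫‖ ^ 2 = ‖⟪x, S x⟫‖ ^ 2 + ‖⟪x, T x⟫‖ ^ 2) :
    ‖S‖ ^ 2 + crawford T ^ 2 ≤ numRadius A ^ 2 := by
  have key : ∀ x : E, ‖x‖ = 1 → ‖⟪x, S x⟫‖ ^ 2 ≤ numRadius A ^ 2 - crawford T ^ 2 := by
    intro x hx
    have hA := pow_le_pow_left₀ (norm_nonneg _) (norm_inner_le_numRadius A hx) 2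
    have hT := pow_le_pow_left₀ (crawford_nonneg T) (crawford_le_norm_inner T hx) 2
    linarith [h x]
  obtain ⟨x₀, hx₀⟩ := exists_norm_eq E zero_le_one
  have hD := (sq_nonneg _).trans (key x₀ hx₀)
  have hn := norm_le_of_norm_inner_le hS (Real.sqrt_nonneg _)
    fun x hx ↦ Real.le_sqrt_of_sq_le (key x hx)
  linarith [(Real.le_sqrt (norm_nonneg S) hD).1 hn]

/-- For every `A ∈ B(H)`, `w(A)² ≥ ‖Re(A)‖² + c(Im(A))²` and
`w(A)² ≥ ‖Im(A)‖² + c(Re(A))²`. -/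
theorem stmt8 (A : H →L[ℂ] H) :
    numRadius A ^ 2 ≥ ‖reOp A‖ ^ 2 + crawford (imOp A) ^ 2 ∧
      numRadius A ^ 2 ≥ ‖imOp A‖ ^ 2 + crawford (reOp A) ^ 2 := by
  exact ⟨sq_norm_add_sq_crawford_le (isSymmetric_of_inner_self_real (inner_reOp A))
      (sq_norm_inner_eq_add A),
    sq_norm_add_sq_crawford_le (isSymmetric_of_inner_self_real (inner_imOp A))
      fun x ↦ (sq_norm_inner_eq_add A x).trans (add_comm _ _)⟩
end
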